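/- Let m > n be positive integers. There exists an involution Ψ : D_{m,n} → D_{m,n} (i.e., Ψ(Ψ(P)) = P for every P ∈ D_{m,n}) such that for every P ∈ D_{m,n}: comp(Ψ(P)) = comp(P), r̃un(Ψ(P)) = ret(P), and ret(Ψ(P)) = r̃un(P). -/

import Mathlib

open scoped Classical

namespace RationalDyck

/-- A lattice path: `true` = a north step `N`, `false` = an east step `E`. -/
abbrev Path : Type := List Bool

/-- The rank of the endpoint of a path prefix `Q` in the `m × n` grid:
`rank(i,j) = j*m - i*n`, where `i` is the number of east steps of `Q`
and `j` the number of north steps of `Q`. -/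
def prefRank (m n : ℕ) (Q : Path) : ℤ :=
  (Q.count true : ℤ) * m - (Q.count false : ℤ) * n

/-- `P` is an `m × n` rational Dyck path: it goes from `(0,0)` to `(m,n)` and
stays weakly above the line `y = n x / m`. -/
def IsDyck (m n : ℕ) (P : Path) : Prop :=
  P.count false = m ∧ P.count true = n ∧ ∀ i ≤ P.length, 0 ≤ prefRank m n (P.take i)

/-- The return statistic: the number of lattice points on `P` other than `(m,n)`
whose rank is strictly less than `n`. -/
def retStat (m n : ℕ) (P : Path) : ℕ :=
  ((List.range P.length).filter fun i => prefRank m n (P.take i) < (n : ℤ)).length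

/-- The coarea sequence of `P`: for each north step (from bottom to top), the number
of cells of the rectangle strictly to its left, i.e. the number of east steps before it. -/
def coarea (P : Path) : List ℕ :=
  (List.range P.length).filterMap fun i =>
    if P.getD i false = true then some ((P.take i).count false) else none

/-- The run statistic: the least `i ∈ [n]` not appearing in the coarea sequence. -/
noncomputable def runStat (P : Path) : ℕ :=
  sInf {i : ℕ | 1 ≤ i ∧ i ≤ P.count true ∧ i ∉ coarea P}

/-- The ratio-run statistic: with `k = ⌊m/n⌋`, the least `i ∈ [n]` such that `k*i`
does not appear in the coarea sequence. -/
noncomputable def ratioRun (m n : ℕ) (P : Path) : ℕ :=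
  sInf {i : ℕ | 1 ≤ i ∧ i ≤ P.count true ∧ (m / n) * i ∉ coarea P}

/-- The composition type of `P`: the lengths of the maximal blocks of consecutive
north steps, read from start to end. -/
def compType (P : Path) : List ℕ :=
  ((P.splitOn false).map List.length).filter fun x => x ≠ 0

/-- The number of maximal blocks of consecutive north steps (vertical components). -/
def nc (P : Path) : ℕ := (compType P).length

/-- `α` is a (strong) composition of `n`. -/
def IsComposition (n : ℕ) (α : List ℕ) : Prop :=
  (∀ a ∈ α, 0 < a) ∧ α.sum = n

/-- The finite set of all `m × n` rational Dyck paths. -/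
noncomputable def dyckPaths (m n : ℕ) : Finset Path :=
  ((Finset.univ : Finset (Fin (m + n) → Bool)).image List.ofFn).filter fun P => IsDyck m n P

/-- The `m × n` rational Dyck paths of composition type `α`. -/
noncomputable def dyckPathsComp (m n : ℕ) (α : List ℕ) : Finset Path :=
  (dyckPaths m n).filter fun P => compType P = α

/-- The `m × n` rational Dyck paths with `run = k` and `ret = l`. -/
noncomputable def dyckPathsRR (m n k l : ℕ) : Finset Path :=
  (dyckPaths m n).filter fun P => runStat P = k ∧ retStat m n P = l

/-- The `m × n` rational Dyck paths of composition type `α` with `run = k` and `ret = l`. -/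
noncomputable def dyckPathsCompRR (m n : ℕ) (α : List ℕ) (k l : ℕ) : Finset Path :=
  (dyckPathsComp m n α).filter fun P => runStat P = k ∧ retStat m n P = l

/-- The number of initial parts of `α` equal to `1`. -/
def iones (α : List ℕ) : ℕ := (α.takeWhile fun a => a = 1).length

/-- `rr(α, m) = min(Iones(α) + 1, ⌈n/(m-n)⌉)` where `n = |α|` is the sum of parts. -/
def rr (m : ℕ) (α : List ℕ) : ℕ :=
  min (iones α + 1) ((α.sum + (m - α.sum) - 1) / (m - α.sum))

/-- The number of `0`-`1` words of length `L`, with as many ones as `bs` has entries, whose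
columns are numbered from `i` on, whose `t`-th one is at column at most `bs[t]`, and for which
exactly `a` of these bounds are attained. -/
def tightCount : ℕ → ℕ → List ℕ → ℕ → ℕ
  | 0, _, [], a => if a = 0 then 1 else 0
  | 0, _, _ :: _, _ => 0
  | L + 1, i, [], a => tightCount L (i + 1) [] a
  | L + 1, i, b :: bs, a =>
    if b ≤ i then
      match a with
      | 0 => 0
      | a + 1 => tightCount L (i + 1) bs a
    else tightCount L (i + 1) bs a + tightCount L (i + 1) (b :: bs) a

/-- The number of words counted by `tightCount L i bs a` in which moreover exactly `j` multiples
of `k`, starting with the first one that is at least `i`, carry a one before the first multiple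
of `k` that does not. -/
def jointCount (k : ℕ) : ℕ → ℕ → List ℕ → ℕ → ℕ → ℕ
  | 0, _, [], a, j => if a = 0 ∧ j = 0 then 1 else 0
  | 0, _, _ :: _, _, _ => 0
  | L + 1, i, [], a, j =>
    if k ∣ i then (if j = 0 then tightCount L (i + 1) [] a else 0)
    else jointCount k L (i + 1) [] a j
  | L + 1, i, b :: bs, a, j =>
    if k ∣ i then
      match a, j with
      | 0, 0 => if b ≤ i then 0 else tightCount L (i + 1) (b :: bs) 0
      | 0, j + 1 => if b ≤ i then 0 else jointCount k L (i + 1) bs 0 j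
      | a + 1, 0 => if b ≤ i then 0 else tightCount L (i + 1) (b :: bs) (a + 1)
      | a + 1, j + 1 =>
        if b ≤ i then jointCount k L (i + 1) bs a j
        else jointCount k L (i + 1) bs (a + 1) j
    else if b ≤ i then
      match a with
      | 0 => 0
      | a + 1 => jointCount k L (i + 1) bs a j
    else jointCount k L (i + 1) bs a j + jointCount k L (i + 1) (b :: bs) a j

theorem tightCount_nil (L i a : ℕ) : tightCount L i [] a = if a = 0 then 1 else 0 := by
  induction L generalizing i with
  | zero => simp [tightCount]
  | succ L ih => simp [tightCount, ih]

theorem jointCount_nil (k L i a j : ℕ) :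
    jointCount k L i [] a j = if a = 0 ∧ j = 0 then 1 else 0 := by
  induction L generalizing i with
  | zero => simp [jointCount]
  | succ L ih =>
    simp only [jointCount, ih, tightCount_nil]
    split_ifs <;> simp_all

theorem tightCount_succ_of_lt {L i b : ℕ} (h : i < b) (bs : List ℕ) (a : ℕ) :
    tightCount (L + 1) i (b :: bs) a =
      tightCount L (i + 1) bs a + tightCount L (i + 1) (b :: bs) a := by
  cases a <;> simp [tightCount, h]

theorem jointCount_succ_of_not_dvd {k L i b : ℕ} (hk : ¬ k ∣ i) (h : i < b) (bs : List ℕ)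
    (a j : ℕ) :
    jointCount k (L + 1) i (b :: bs) a j =
      jointCount k L (i + 1) bs a j + jointCount k L (i + 1) (b :: bs) a j := by
  cases a <;> simp [jointCount, hk, h]

theorem jointCount_succ_zero {k L i b : ℕ} (hk : k ∣ i) (h : i < b) (bs : List ℕ) (a : ℕ) :
    jointCount k (L + 1) i (b :: bs) a 0 = tightCount L (i + 1) (b :: bs) a := by
  cases a <;> simp [jointCount, hk, h]

theorem jointCount_succ_succ {k L i b : ℕ} (hk : k ∣ i) (h : i < b) (bs : List ℕ) (a j : ℕ) :
    jointCount k (L + 1) i (b :: bs) a (j + 1) = jointCount k L (i + 1) bs a j := by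
  cases a <;> simp [jointCount, hk, h]

theorem tightCount_cons_add (L i b : ℕ) (bs : List ℕ) (a : ℕ) (hib : i ≤ b)
    (hp : (b :: bs).Pairwise (· < ·)) (hL : ∀ c ∈ b :: bs, c < i + L) :
    tightCount L i (b :: bs) (a + 1) + tightCount L i bs (a + 1) = tightCount L i bs a := by
  induction L generalizing i b bs with
  | zero => have := hL b (by simp); omega
  | succ L ih =>
    have hL' : ∀ c ∈ b :: bs, c < i + 1 + L := fun c hc => by have := hL c hc; omega
    rcases bs with _ | ⟨c, bs⟩
    · rcases hib.eq_or_lt with rfl | hlt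
      · simp [tightCount, tightCount_nil]
      · have := ih (i + 1) b [] hlt hp hL'
        simp only [tightCount_succ_of_lt hlt, tightCount_nil] at this ⊢
        simpa using this
    · have hbc : b < c := (List.pairwise_cons.1 hp).1 c (by simp)
      have hc := ih (i + 1) c bs (by omega) (List.pairwise_cons.1 hp).2
        fun x hx => hL' x (List.mem_cons_of_mem _ hx)
      rw [tightCount_succ_of_lt (show i < c by omega), tightCount_succ_of_lt (show i < c by omega)]
      rcases hib.eq_or_lt with rfl | hlt
      · simp only [tightCount, le_refl, if_true]
        omega
      · have := ih (i + 1) b (c :: bs) hlt hp hL'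
        rw [tightCount_succ_of_lt hlt]
        omega

theorem succ_le_mul_of_not_dvd {k i q : ℕ} (hk : ¬ k ∣ i) (h : i ≤ k * q) : i + 1 ≤ k * q := by
  rcases h.eq_or_lt with rfl | h
  · exact absurd (dvd_mul_right k q) hk
  · exact h

theorem pairwise_lt_of_pairwise_add_le {k : ℕ} (hk : 0 < k) {bs : List ℕ}
    (h : bs.Pairwise (· + k ≤ ·)) : bs.Pairwise (· < ·) :=
  h.imp fun h => by omega

theorem jointCount_zero_add (k L i : ℕ) (hk : 0 < k) (bs : List ℕ) (a : ℕ)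
    (hp : bs.Pairwise (· + k ≤ ·)) (hL : ∀ c ∈ bs, c < i + L)
    (hq : ∀ c ∈ bs, ∃ q, i ≤ k * q ∧ k * q < c) :
    jointCount k L i bs a 0 + tightCount L i bs (a + 1) = tightCount L i bs a := by
  induction L generalizing i bs with
  | zero => cases bs <;> simp [jointCount, tightCount]
  | succ L ih =>
    rcases bs with _ | ⟨b, bs⟩
    · simp [jointCount_nil, tightCount_nil]
    · have hL' : ∀ c ∈ b :: bs, c < i + 1 + L := fun c hc => by have := hL c hc; omega
      obtain ⟨q, hiq, hqb⟩ := hq b (by simp)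
      have hlt : i < b := by omega
      by_cases hd : k ∣ i
      · have := tightCount_cons_add L (i + 1) b bs a hlt (pairwise_lt_of_pairwise_add_le hk hp) hL'
        rw [jointCount_succ_zero hd hlt, tightCount_succ_of_lt hlt, tightCount_succ_of_lt hlt]
        omega
      · have hq' : ∀ c ∈ b :: bs, ∃ q, i + 1 ≤ k * q ∧ k * q < c := fun c hc => by
          obtain ⟨q, h1, h2⟩ := hq c hc
          exact ⟨q, succ_le_mul_of_not_dvd hd h1, h2⟩
        have h1 := ih (i + 1) (b :: bs) hp hL' hq'
        have h2 := ih (i + 1) bs (List.pairwise_cons.1 hp).2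
          (fun c hc => hL' c (List.mem_cons_of_mem _ hc))
          (fun c hc => hq' c (List.mem_cons_of_mem _ hc))
        rw [jointCount_succ_of_not_dvd hd hlt, tightCount_succ_of_lt hlt, tightCount_succ_of_lt hlt]
        omega

theorem jointCount_succ_left (k L i : ℕ) (hk : 0 < k) (bs : List ℕ) (a j : ℕ)
    (hp : bs.Pairwise (· + k ≤ ·)) (hL : ∀ c ∈ bs, c < i + L)
    (hq : ∀ c ∈ bs, ∃ q, i ≤ k * q ∧ k * q < c) :
    jointCount k L i bs (a + 1) j = jointCount k L i bs a (j + 1) := by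
  induction L generalizing i bs j with
  | zero => cases bs <;> simp [jointCount]
  | succ L ih =>
    rcases bs with _ | ⟨b, bs⟩
    · simp [jointCount_nil]
    · have hL' : ∀ c ∈ b :: bs, c < i + 1 + L := fun c hc => by have := hL c hc; omega
      have hLt : ∀ c ∈ bs, c < i + 1 + L := fun c hc => hL' c (List.mem_cons_of_mem _ hc)
      obtain ⟨hpb, hpt⟩ := List.pairwise_cons.1 hp
      obtain ⟨q, hiq, hqb⟩ := hq b (by simp)
      have hlt : i < b := by omega
      by_cases hd : k ∣ i
      · have hqt : ∀ c ∈ bs, ∃ q, i + 1 ≤ k * q ∧ k * q < c := fun c hc => by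
          obtain ⟨r, rfl⟩ := hd
          have := hpb c hc
          exact ⟨r + 1, by rw [mul_add]; omega, by rw [mul_add]; omega⟩
        rw [jointCount_succ_succ hd hlt]
        cases j with
        | zero =>
          have h1 := tightCount_cons_add L (i + 1) b bs a hlt
            (pairwise_lt_of_pairwise_add_le hk hp) hL'
          have h2 := jointCount_zero_add k L (i + 1) hk bs a hpt hLt hqt
          rw [jointCount_succ_zero hd hlt]
          omega
        | succ j =>
          rw [jointCount_succ_succ hd hlt]
          exact ih (i + 1) bs j hpt hLt hqt
      · have hq' : ∀ c ∈ b :: bs, ∃ q, i + 1 ≤ k * q ∧ k * q < c := fun c hc => by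
          obtain ⟨q, h1, h2⟩ := hq c hc
          exact ⟨q, succ_le_mul_of_not_dvd hd h1, h2⟩
        rw [jointCount_succ_of_not_dvd hd hlt, jointCount_succ_of_not_dvd hd hlt,
          ih (i + 1) (b :: bs) j hp hL' hq',
          ih (i + 1) bs j hpt hLt fun c hc => hq' c (List.mem_cons_of_mem _ hc)]

theorem comm_of_succ_left {f : ℕ → ℕ → ℕ} (h : ∀ a j, f (a + 1) j = f a (j + 1)) (a j : ℕ) :
    f a j = f j a := by
  have key : ∀ a j, f a j = f 0 (a + j) := fun a => by
    induction a with
    | zero => simp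
    | succ a ih =>
      intro j
      rw [h, ih]
      congr 1
      omega
  rw [key, key j, add_comm]

theorem jointCount_comm (k L i : ℕ) (hk : 0 < k) (bs : List ℕ) (a j : ℕ)
    (hp : bs.Pairwise (· + k ≤ ·)) (hL : ∀ c ∈ bs, c < i + L)
    (hq : ∀ c ∈ bs, ∃ q, i ≤ k * q ∧ k * q ≤ c) :
    jointCount k L i bs a j = jointCount k L i bs j a := by
  induction L generalizing i bs a j with
  | zero => cases bs <;> simp [jointCount, and_comm]
  | succ L ih =>
    rcases bs with _ | ⟨b, bs⟩
    · simp [jointCount_nil, and_comm]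
    · have hL' : ∀ c ∈ b :: bs, c < i + 1 + L := fun c hc => by have := hL c hc; omega
      have hLt : ∀ c ∈ bs, c < i + 1 + L := fun c hc => hL' c (List.mem_cons_of_mem _ hc)
      obtain ⟨hpb, hpt⟩ := List.pairwise_cons.1 hp
      obtain ⟨q, hiq, hqb⟩ := hq b (by simp)
      by_cases hd : k ∣ i
      · rcases (hiq.trans hqb).eq_or_lt with rfl | hlt
        · have hqt : ∀ c ∈ bs, ∃ q, i + 1 ≤ k * q ∧ k * q ≤ c := fun c hc => by
            obtain ⟨r, rfl⟩ := hd
            have := hpb c hc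
            exact ⟨r + 1, by rw [mul_add]; omega, by rw [mul_add]; omega⟩
          cases a <;> cases j <;> simp [jointCount, hd]
          exact ih (i + 1) bs _ _ hpt hLt hqt
        · refine comm_of_succ_left (fun a j => jointCount_succ_left k (L + 1) i hk (b :: bs) a j
            hp hL fun c hc => ?_) a j
          obtain ⟨r, rfl⟩ := hd
          refine ⟨r, le_rfl, ?_⟩
          rcases List.mem_cons.1 hc with rfl | hc
          · exact hlt
          · have := hpb c hc
            omega
      · have hlt : i < b := (succ_le_mul_of_not_dvd hd hiq).trans hqb
        have hq' : ∀ c ∈ b :: bs, ∃ q, i + 1 ≤ k * q ∧ k * q ≤ c := fun c hc => by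
          obtain ⟨q, h1, h2⟩ := hq c hc
          exact ⟨q, succ_le_mul_of_not_dvd hd h1, h2⟩
        rw [jointCount_succ_of_not_dvd hd hlt, jointCount_succ_of_not_dvd hd hlt,
          ih (i + 1) (b :: bs) a j hp hL' hq',
          ih (i + 1) bs a j hpt hLt fun c hc => hq' c (List.mem_cons_of_mem _ hc)]

/-- The path whose `x`-th column, counted from `0`, carries `h[x]` north steps, each column being
followed by an east step. -/
def ofHeights : List ℕ → Path
  | [] => []
  | x :: h => List.replicate x true ++ false :: ofHeights h

/-- The numbers of north steps in the columns of a path, the last column excepted. -/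
def heights (P : Path) : List ℕ :=
  ((P.splitOn false).map List.length).dropLast

/-- Columns with heights `h`, the first of them in abscissa `i` and starting at ordinate `H`, stay
above the diagonal of the `m × n` rectangle. -/
def StaysAbove (m n : ℕ) : ℕ → ℕ → List ℕ → Prop
  | _, _, [] => True
  | i, H, x :: h => (i + 1) * n ≤ (H + x) * m ∧ StaysAbove m n (i + 1) (H + x) h

/-- The number of lattice points of rank less than `n` on columns with heights `h`, the first of
them in abscissa `i` and starting at ordinate `H`. -/
def returns (m n : ℕ) : ℕ → ℕ → List ℕ → ℕ
  | _, _, [] => 0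
  | i, H, x :: h => (if H * m < (i + 1) * n then 1 else 0) + returns m n (i + 1) (H + x) h

/-- The number of nonzero entries of `h` at multiples of `k` that precede the first zero entry at
a multiple of `k`, the entries being indexed from `i` on. -/
def multipleRun (k : ℕ) : ℕ → List ℕ → ℕ
  | _, [] => 0
  | i, x :: h =>
    if k ∣ i then (if x = 0 then 0 else 1 + multipleRun k (i + 1) h) else multipleRun k (i + 1) h

/-- The latest admissible abscissae of blocks of north steps of lengths `α`, the first of which
starts at ordinate `H`. -/
def blockBounds (m n : ℕ) : ℕ → List ℕ → List ℕ
  | _, [] => []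
  | H, a :: α => H * m / n :: blockBounds m n (H + a) α

/-- The column heights, for `L` columns from abscissa `i` on and starting at ordinate `H`, that have
nonzero entries `α` and stay above the diagonal. -/
def heightLists (m n : ℕ) : ℕ → ℕ → ℕ → List ℕ → List (List ℕ)
  | 0, _, _, [] => [[]]
  | 0, _, _, _ :: _ => []
  | L + 1, i, H, [] => (heightLists m n L (i + 1) H []).map (List.cons 0)
  | L + 1, i, H, a :: α =>
    (heightLists m n L (i + 1) (H + a) α).map (List.cons a) ++
      if H * m < (i + 1) * n then []
      else (heightLists m n L (i + 1) H (a :: α)).map (List.cons 0)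

section HeightLists

variable {m n : ℕ}

theorem mem_heightLists (hn : n < m) (L i H : ℕ) (α h : List ℕ) (hL : i + L = m)
    (hH : H + α.sum = n) (hi : i * n ≤ H * m) (hα : ∀ a ∈ α, 0 < a) :
    h ∈ heightLists m n L i H α ↔
      h.length = L ∧ (h.filter fun x => x ≠ 0) = α ∧ StaysAbove m n i H h := by
  induction L generalizing i H α h with
  | zero =>
    cases α with
    | nil => cases h <;> simp [heightLists, StaysAbove]
    | cons a α => cases h <;> simp [heightLists]
  | succ L ih =>
    cases α with
    | nil =>
      have hH' : H = n := by simpa using hH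
      subst hH'
      have hi' : (i + 1) * H ≤ H * m := by
        rw [mul_comm]
        exact Nat.mul_le_mul le_rfl (by omega)
      cases h with
      | nil => simp [heightLists]
      | cons x h =>
        have := ih (i + 1) H [] h (by omega) hH hi' (by simp)
        by_cases hx : x = 0
        · subst hx
          simp [heightLists, StaysAbove, this, hi']
        · simp [heightLists, hx, Ne.symm hx]
    | cons a α =>
      have ha : 0 < a := hα a (by simp)
      have hs : H + (a + α.sum) = n := by simpa using hH
      have hi' : (i + 1) * n ≤ (H + a) * m := by
        have : 1 * m ≤ a * m := Nat.mul_le_mul ha le_rfl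
        rw [add_mul, add_mul]
        omega
      have h1 := fun h => ih (i + 1) (H + a) α h (by omega) (by omega) hi'
        fun b hb => hα b (List.mem_cons_of_mem _ hb)
      cases h with
      | nil =>
        simp only [heightLists, List.mem_append]
        split_ifs <;> simp
      | cons x h =>
        by_cases hf : H * m < (i + 1) * n
        · by_cases hx : x = 0
          · subst hx
            simp [heightLists, StaysAbove, hf, ha.ne']
          · simp only [heightLists, if_pos hf, List.append_nil, List.mem_map, List.cons.injEq,
              List.length_cons, StaysAbove, List.filter_cons, ne_eq, hx, not_false_eq_true,
              decide_true, if_true]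
            constructor
            · rintro ⟨h', hm, rfl, rfl⟩
              obtain ⟨e1, e2, e3⟩ := (h1 _).1 hm
              exact ⟨by omega, ⟨rfl, e2⟩, hi', e3⟩
            · rintro ⟨e1, ⟨rfl, e2⟩, -, e3⟩
              exact ⟨h, (h1 _).2 ⟨by omega, e2, e3⟩, rfl, rfl⟩
        · have h2 := ih (i + 1) H (a :: α) h (by omega) hH (by omega) hα
          by_cases hx : x = 0
          · subst hx
            simp [heightLists, StaysAbove, hf, ha.ne', h2]
            intro _ _ _
            omega
          · simp only [heightLists, if_neg hf, List.mem_append, List.mem_map, List.cons.injEq,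
              List.length_cons, StaysAbove, List.filter_cons, ne_eq, hx, not_false_eq_true,
              decide_true, if_true, Ne.symm hx, false_and, and_false, exists_false, or_false]
            constructor
            · rintro ⟨h', hm, rfl, rfl⟩
              obtain ⟨e1, e2, e3⟩ := (h1 _).1 hm
              exact ⟨by omega, ⟨rfl, e2⟩, hi', e3⟩
            · rintro ⟨e1, ⟨rfl, e2⟩, -, e3⟩
              exact ⟨h, (h1 _).2 ⟨by omega, e2, e3⟩, rfl, rfl⟩

theorem nodup_heightLists (L i H : ℕ) (α : List ℕ) (hα : ∀ a ∈ α, 0 < a) :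
    (heightLists m n L i H α).Nodup := by
  have hc : ∀ x : ℕ, Function.Injective (List.cons x) := fun x => List.cons_injective
  induction L generalizing i H α with
  | zero => cases α <;> simp [heightLists]
  | succ L ih =>
    cases α with
    | nil => exact (ih _ _ _ hα).map (hc 0)
    | cons a α =>
      have h1 := (ih (i + 1) (H + a) α fun b hb => hα b (List.mem_cons_of_mem _ hb)).map (hc a)
      rw [heightLists]
      split_ifs
      · simpa using h1
      · refine h1.append ((ih _ _ _ hα).map (hc 0)) ?_
        intro h h1 h2
        obtain ⟨_, _, rfl⟩ := List.mem_map.1 h1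
        obtain ⟨_, _, h2⟩ := List.mem_map.1 h2
        have := hα a (by simp)
        simp at h2
        omega

theorem div_le_iff_lt (hn : 0 < n) (H i : ℕ) : H * m / n ≤ i ↔ H * m < (i + 1) * n := by
  rw [← Nat.lt_succ_iff, Nat.div_lt_iff_lt_mul hn]

theorem countP_returns (hn : 0 < n) (L i H : ℕ) (α : List ℕ) (a : ℕ) (hL : i + L = m)
    (hH : H + α.sum = n) :
    (heightLists m n L i H α).countP (fun h => decide (returns m n i H h = a)) =
      tightCount L i (blockBounds m n H α) a := by
  induction L generalizing i H α a with
  | zero => cases α <;> cases a <;> simp [heightLists, tightCount, blockBounds, returns]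
  | succ L ih =>
    cases α with
    | nil =>
      have hH' : H = n := by simpa using hH
      have hf : ¬ H * m < (i + 1) * n := by
        rw [hH', mul_comm, not_lt]
        exact Nat.mul_le_mul (by omega) le_rfl
      have := ih (i + 1) H [] a (by omega) hH
      simpa [heightLists, List.countP_map, Function.comp_def, returns, hf, blockBounds,
        tightCount] using this
    | cons b α =>
      have hs : H + (b + α.sum) = n := by simpa using hH
      have h1 := fun a => ih (i + 1) (H + b) α a (by omega) (by omega)
      have h2 := ih (i + 1) H (b :: α) a (by omega) hH
      simp only [heightLists, blockBounds, tightCount, div_le_iff_lt hn, List.countP_append,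
        List.countP_map, Function.comp_def, returns] at h1 h2 ⊢
      by_cases hf : H * m < (i + 1) * n
      · cases a with
        | zero => simp [hf]
        | succ a => simp [hf, ← h1, add_comm 1]
      · simp [hf, List.countP_map, Function.comp_def, returns, ← h1, ← h2]

theorem countP_returns_multipleRun (hn : 0 < n) (k L i H : ℕ) (α : List ℕ) (a j : ℕ)
    (hL : i + L = m) (hH : H + α.sum = n) (hα : ∀ a ∈ α, 0 < a) :
    (heightLists m n L i H α).countP
        (fun h => decide (returns m n i H h = a ∧ multipleRun k i h = j)) =
      jointCount k L i (blockBounds m n H α) a j := by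
  induction L generalizing i H α a j with
  | zero =>
    cases α <;> cases a <;> cases j <;>
      simp [heightLists, jointCount, blockBounds, returns, multipleRun]
  | succ L ih =>
    cases α with
    | nil =>
      have hH' : H = n := by simpa using hH
      have hf : ¬ H * m < (i + 1) * n := by
        rw [hH', mul_comm, not_lt]
        exact Nat.mul_le_mul (by omega) le_rfl
      have h1 := ih (i + 1) H [] a j (by omega) hH hα
      have h2 := countP_returns (m := m) hn L (i + 1) H [] a (by omega) hH
      by_cases hd : k ∣ i
      · cases j with
        | zero =>
          simpa [heightLists, List.countP_map, Function.comp_def, returns, hf, blockBounds,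
            multipleRun, hd, jointCount] using h2
        | succ j =>
          simp [heightLists, List.countP_map, Function.comp_def, returns, hf, blockBounds,
            multipleRun, hd, jointCount]
      · simpa [heightLists, List.countP_map, Function.comp_def, returns, hf, blockBounds,
          multipleRun, hd, jointCount] using h1
    | cons b α =>
      have hs : H + (b + α.sum) = n := by simpa using hH
      have hb : b ≠ 0 := (hα b (by simp)).ne'
      have h1 := fun a j => ih (i + 1) (H + b) α a j (by omega) (by omega)
        fun b hb => hα b (List.mem_cons_of_mem _ hb)
      have h2 := ih (i + 1) H (b :: α) a j (by omega) hH hα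
      have h3 := countP_returns (m := m) hn L (i + 1) H (b :: α) a (by omega) hH
      simp only [heightLists, blockBounds, div_le_iff_lt hn, List.countP_append,
        List.countP_map, Function.comp_def, returns, multipleRun, jointCount] at h1 h2 h3 ⊢
      by_cases hf : H * m < (i + 1) * n <;> by_cases hd : k ∣ i <;> cases a <;> cases j <;>
        simp [hf, hd, hb, List.countP_map, Function.comp_def, returns, multipleRun, ← h1, ← h2,
          ← h3, add_comm 1]

theorem heightLists_stats_comm (hn : 0 < n) (hmn : n < m) (α : List ℕ) (hα : ∀ a ∈ α, 0 < a)
    (hs : α.sum = n) (a j : ℕ) :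
    (heightLists m n m 0 0 α).countP
        (fun h => decide (returns m n 0 0 h = a ∧ multipleRun (m / n) 0 h = j)) =
      (heightLists m n m 0 0 α).countP
        (fun h => decide (returns m n 0 0 h = j ∧ multipleRun (m / n) 0 h = a)) := by
  have hbound : ∀ (H : ℕ) (α : List ℕ), (∀ a ∈ α, 0 < a) → H + α.sum = n →
      (∀ c ∈ blockBounds m n H α, H * m / n ≤ c ∧ c < m) ∧
        (blockBounds m n H α).Pairwise (· + m / n ≤ ·) := by
    intro H α
    induction α generalizing H with
    | nil => simp [blockBounds]
    | cons a α ih =>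
      intro hα hs
      have ha : 0 < a := hα a (by simp)
      have hs : H + (a + α.sum) = n := by simpa using hs
      obtain ⟨h1, h2⟩ := ih (H + a) (fun b hb => hα b (List.mem_cons_of_mem _ hb)) (by omega)
      have hlt : H * m / n < m := by
        rw [Nat.div_lt_iff_lt_mul hn, mul_comm]
        exact Nat.mul_lt_mul_of_pos_left (by omega) (by omega)
      have hstep : H * m / n + m / n ≤ (H + a) * m / n := by
        refine Nat.div_add_div_le_add_div.trans (Nat.div_le_div_right ?_)
        have : 1 * m ≤ a * m := Nat.mul_le_mul ha le_rfl
        rw [add_mul]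
        omega
      simp only [blockBounds, List.mem_cons, forall_eq_or_imp, List.pairwise_cons]
      refine ⟨⟨⟨le_rfl, hlt⟩, fun c hc => ?_⟩, fun c hc => hstep.trans (h1 c hc).1, h2⟩
      have := h1 c hc
      exact ⟨(Nat.le_add_right _ _).trans (hstep.trans this.1), this.2⟩
  obtain ⟨h1, h2⟩ := hbound 0 α hα (by omega)
  rw [countP_returns_multipleRun hn _ _ _ _ _ _ _ (by omega) (by omega) hα,
    countP_returns_multipleRun hn _ _ _ _ _ _ _ (by omega) (by omega) hα]
  refine jointCount_comm _ _ _ (Nat.div_pos hmn.le hn) _ _ _ h2 (fun c hc => ?_) fun c hc => ?_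
  · have := h1 c hc
    omega
  · exact ⟨0, by simp, by simp⟩

end HeightLists

theorem ofHeights_append_replicate (P : Path) :
    ∃ h r, P = ofHeights h ++ List.replicate r true := by
  induction P with
  | nil => exact ⟨[], 0, rfl⟩
  | cons s P ih =>
    obtain ⟨h, r, rfl⟩ := ih
    cases s
    · exact ⟨0 :: h, r, by simp [ofHeights]⟩
    · cases h with
      | nil => exact ⟨[], r + 1, by simp [ofHeights, List.replicate_succ]⟩
      | cons x h => exact ⟨(x + 1) :: h, r, by simp [ofHeights, List.replicate_succ]⟩

theorem splitOn_ofHeights (h : List ℕ) :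
    (ofHeights h).splitOn false = h.map (fun x => List.replicate x true) ++ [[]] := by
  induction h with
  | nil => simp [ofHeights]
  | cons x h ih =>
    rw [ofHeights, List.splitOn_append_cons_self_of_not_mem (by simp [List.mem_replicate]), ih]
    simp

theorem heights_ofHeights (h : List ℕ) : heights (ofHeights h) = h := by
  simp [heights, splitOn_ofHeights, Function.comp_def]

theorem ofHeights_injective : Function.Injective ofHeights :=
  Function.LeftInverse.injective heights_ofHeights

theorem compType_ofHeights (h : List ℕ) : compType (ofHeights h) = h.filter fun x => x ≠ 0 := by
  simp [compType, splitOn_ofHeights, Function.comp_def]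

theorem count_true_ofHeights (h : List ℕ) : (ofHeights h).count true = h.sum := by
  induction h with
  | nil => simp [ofHeights]
  | cons x h ih => simp [ofHeights, ih]

theorem count_false_ofHeights (h : List ℕ) : (ofHeights h).count false = h.length := by
  induction h with
  | nil => simp [ofHeights]
  | cons x h ih => simp [ofHeights, ih, List.count_replicate]

theorem prefRank_nil (m n : ℕ) : prefRank m n [] = 0 := by simp [prefRank]

theorem prefRank_true_cons (m n : ℕ) (P : Path) :
    prefRank m n (true :: P) = m + prefRank m n P := by
  simp [prefRank]
  ring

theorem prefRank_false_cons (m n : ℕ) (P : Path) :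
    prefRank m n (false :: P) = -n + prefRank m n P := by
  simp [prefRank]
  ring

/-- All points of the path `P`, started at a point of rank `r`, have nonnegative rank. -/
def RankNonneg (m n : ℕ) (r : ℤ) (P : Path) : Prop :=
  ∀ i ≤ P.length, 0 ≤ r + prefRank m n (P.take i)

theorem rankNonneg_cons (m n : ℕ) (r : ℤ) (s : Bool) (P : Path) :
    RankNonneg m n r (s :: P) ↔ 0 ≤ r ∧ RankNonneg m n (r + prefRank m n [s]) P := by
  have hs : ∀ Q, prefRank m n (s :: Q) = prefRank m n [s] + prefRank m n Q := fun Q => by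
    cases s <;> simp [prefRank_true_cons, prefRank_false_cons, prefRank_nil]
  constructor
  · intro h
    refine ⟨by simpa [prefRank_nil] using h 0 (by simp), fun i hi => ?_⟩
    have := h (i + 1) (by simpa using hi)
    rw [List.take_succ_cons, hs] at this
    linarith
  · rintro ⟨h0, h⟩ i hi
    cases i with
    | zero => simpa [prefRank_nil] using h0
    | succ i =>
      have := h i (by simpa using hi)
      rw [List.take_succ_cons, hs]
      linarith

theorem rankNonneg_replicate_append (m n : ℕ) (r : ℤ) (hr : 0 ≤ r) (x : ℕ) (P : Path) :
    RankNonneg m n r (List.replicate x true ++ P) ↔ RankNonneg m n (r + x * m) P := by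
  induction x generalizing r with
  | zero => simp
  | succ x ih =>
    rw [List.replicate_succ, List.cons_append, rankNonneg_cons, prefRank_true_cons, prefRank_nil,
      ih _ (by positivity)]
    simp only [hr, true_and]
    rw [show r + (m + 0) + x * m = r + (x + 1 : ℕ) * (m : ℤ) by push_cast; ring]

theorem rankNonneg_ofHeights (m n i H : ℕ) (h : List ℕ) (hr : i * n ≤ H * m) :
    RankNonneg m n ((H : ℤ) * m - i * n) (ofHeights h) ↔ StaysAbove m n i H h := by
  induction h generalizing i H with
  | nil =>
    simp only [RankNonneg, ofHeights, StaysAbove, iff_true]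
    intro t _
    simp only [List.take_nil, prefRank_nil]
    have : (i * n : ℤ) ≤ H * m := by exact_mod_cast hr
    linarith
  | cons x h ih =>
    have hr' : (i * n : ℤ) ≤ H * m := by exact_mod_cast hr
    have e : (H : ℤ) * m - i * n + x * m + prefRank m n [false] =
        ((H + x : ℕ) : ℤ) * m - (i + 1 : ℕ) * n := by
      rw [prefRank_false_cons, prefRank_nil]
      push_cast
      ring
    rw [ofHeights, rankNonneg_replicate_append _ _ _ (by linarith), rankNonneg_cons, e, StaysAbove]
    constructor
    · rintro ⟨-, h2⟩
      have h3 := h2 0 (by simp)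
      simp only [List.take_zero, prefRank_nil] at h3
      have h4 : (i + 1) * n ≤ (H + x) * m := by
        zify
        push_cast at h3
        linarith
      exact ⟨h4, (ih _ _ h4).1 h2⟩
    · rintro ⟨h4, h2⟩
      have : (0 : ℤ) ≤ x * m := by positivity
      exact ⟨by linarith, (ih _ _ h4).2 h2⟩

theorem isDyck_ofHeights (m n : ℕ) (h : List ℕ) :
    IsDyck m n (ofHeights h) ↔ h.length = m ∧ h.sum = n ∧ StaysAbove m n 0 0 h := by
  have := rankNonneg_ofHeights m n 0 0 h (by simp)
  simp only [RankNonneg, Nat.cast_zero, zero_mul, sub_zero, zero_add] at this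
  simp only [IsDyck, count_true_ofHeights, count_false_ofHeights, this]

theorem IsDyck.exists_ofHeights {m n : ℕ} (hm : 0 < m) {P : Path} (hP : IsDyck m n P) :
    ∃ h, P = ofHeights h := by
  obtain ⟨h, r, rfl⟩ := ofHeights_append_replicate P
  obtain ⟨h1, h2, h3⟩ := hP
  have h4 := h3 (ofHeights h).length (by simp)
  rw [List.take_left] at h4
  simp only [List.count_append, count_false_ofHeights, count_true_ofHeights,
    List.count_replicate_self, List.count_replicate] at h1 h2
  simp only [prefRank, count_true_ofHeights, count_false_ofHeights] at h4
  have h1 : h.length = m := by simpa using h1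
  rw [h1, ← h2] at h4
  have h5 : (r : ℤ) * m ≤ 0 := by
    push_cast at h4
    nlinarith
  have h6 : r * m ≤ 0 := by exact_mod_cast h5
  have h7 : r = 0 := by
    rcases Nat.mul_eq_zero.1 (Nat.le_zero.1 h6) with h | h <;> omega
  exact ⟨h, by simp [h7]⟩

/-- The number of points, other than its endpoint, of rank less than `n` on the path `P` started
at a point of rank `r`. -/
def lowPoints (m n : ℕ) (r : ℤ) (P : Path) : ℕ :=
  (List.range P.length).countP fun i => r + prefRank m n (P.take i) < (n : ℤ)

theorem lowPoints_cons (m n : ℕ) (r : ℤ) (s : Bool) (P : Path) :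
    lowPoints m n r (s :: P) =
      (if r < n then 1 else 0) + lowPoints m n (r + prefRank m n [s]) P := by
  have hs : ∀ Q, prefRank m n (s :: Q) = prefRank m n [s] + prefRank m n Q := fun Q => by
    cases s <;> simp [prefRank_true_cons, prefRank_false_cons, prefRank_nil]
  simp only [lowPoints, List.length_cons, List.range_succ_eq_map, List.countP_cons,
    List.countP_map, Function.comp_def, List.take_succ_cons, List.take_zero, prefRank_nil]
  rw [add_comm]
  congr 1
  · simp
  · congr 1
    funext i
    refine decide_eq_decide.2 ?_
    rw [hs (P.take i), add_assoc]

theorem lowPoints_replicate_append (m n : ℕ) (hmn : n < m) (r : ℤ) (hr : 0 ≤ r) (x : ℕ) (P : Path)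
    (hx : n ≤ r + x * m) :
    lowPoints m n r (List.replicate x true ++ P) =
      (if r < n then 1 else 0) + lowPoints m n (r + x * m) P := by
  induction x generalizing r with
  | zero =>
    have : ¬ r < n := by simpa using hx
    simp [this]
  | succ x ih =>
    have e : r + (m + 0) + x * m = r + (x + 1 : ℕ) * (m : ℤ) := by push_cast; ring
    have h1 : (n : ℤ) < m := by exact_mod_cast hmn
    have h2 : ¬ r + (m + 0) < n := by linarith
    rw [List.replicate_succ, List.cons_append, lowPoints_cons, prefRank_true_cons, prefRank_nil,
      ih _ (by positivity) (by rwa [e]), e, if_neg h2, zero_add]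

theorem lowPoints_ofHeights (m n : ℕ) (hmn : n < m) (i H : ℕ) (h : List ℕ) (hr : i * n ≤ H * m)
    (hh : StaysAbove m n i H h) :
    lowPoints m n ((H : ℤ) * m - i * n) (ofHeights h) = returns m n i H h := by
  induction h generalizing i H with
  | nil => simp [lowPoints, ofHeights, returns]
  | cons x h ih =>
    obtain ⟨h1, h2⟩ := hh
    have hr' : (i * n : ℤ) ≤ H * m := by exact_mod_cast hr
    have h1' : ((i + 1) * n : ℤ) ≤ (H + x) * m := by exact_mod_cast h1
    have e : (H : ℤ) * m - i * n + x * m + prefRank m n [false] =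
        ((H + x : ℕ) : ℤ) * m - (i + 1 : ℕ) * n := by
      rw [prefRank_false_cons, prefRank_nil]
      push_cast
      ring
    have h3 : ¬ (H : ℤ) * m - i * n + x * m < n := by linarith
    have h4 : (H : ℤ) * m - i * n < n ↔ H * m < (i + 1) * n := by
      zify
      constructor <;> intro h <;> linarith
    rw [ofHeights, lowPoints_replicate_append _ _ hmn _ (by linarith) _ _ (by linarith),
      lowPoints_cons, if_neg h3, zero_add, e, ih _ _ h1 h2, returns]
    simp only [h4]

theorem retStat_ofHeights (m n : ℕ) (hmn : n < m) (h : List ℕ) (hh : StaysAbove m n 0 0 h) :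
    retStat m n (ofHeights h) = returns m n 0 0 h := by
  have := lowPoints_ofHeights m n hmn 0 0 h (by simp) hh
  simp only [lowPoints, Nat.cast_zero, zero_mul, sub_zero, zero_add] at this
  rw [← this, retStat, List.countP_eq_length_filter]

theorem coarea_true_cons (P : Path) : coarea (true :: P) = 0 :: coarea P := by
  simp [coarea, List.range_succ_eq_map, List.filterMap_map]

theorem coarea_false_cons (P : Path) : coarea (false :: P) = (coarea P).map (· + 1) := by
  simp only [coarea, List.length_cons, List.range_succ_eq_map, List.filterMap_cons,
    List.filterMap_map, Function.comp_def, List.map_filterMap]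
  simp

theorem mem_coarea_ofHeights (h : List ℕ) (x : ℕ) :
    x ∈ coarea (ofHeights h) ↔ h.getD x 0 ≠ 0 := by
  induction h generalizing x with
  | nil => simp [ofHeights, coarea]
  | cons y h ih =>
    have key : ∀ y, x ∈ coarea (List.replicate y true ++ false :: ofHeights h) ↔
        (x = 0 ∧ y ≠ 0) ∨ x ∈ (coarea (ofHeights h)).map (· + 1) := fun y => by
      induction y with
      | zero => simp [coarea_false_cons]
      | succ y ihy =>
        rw [List.replicate_succ, List.cons_append, coarea_true_cons, List.mem_cons, ihy]
        tauto
    rw [ofHeights, key]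
    cases x with
    | zero => simp
    | succ x => simp [ih]

theorem multipleRun_spec (k i q : ℕ) (hk : 0 < k) (h : List ℕ) (h1 : i ≤ k * q)
    (h2 : k * q < i + k) :
    (∀ t < multipleRun k i h, h.getD (k * (q + t) - i) 0 ≠ 0) ∧
      h.getD (k * (q + multipleRun k i h) - i) 0 = 0 := by
  induction h generalizing i q with
  | nil => simp [multipleRun]
  | cons x h ih =>
    have hcons : ∀ y, i + 1 ≤ y → (x :: h).getD (y - i) 0 = h.getD (y - (i + 1)) 0 := by
      intro y hy
      obtain ⟨z, rfl⟩ := Nat.exists_eq_add_of_le hy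
      rw [show i + 1 + z - i = z + 1 by omega, show i + 1 + z - (i + 1) = z by omega]
      simp
    by_cases hd : k ∣ i
    · obtain ⟨r, rfl⟩ := hd
      have hq : q = r := by
        have h3 : q < r + 1 := Nat.lt_of_mul_lt_mul_left (a := k) (by rw [mul_add]; omega)
        have h4 : r ≤ q := Nat.le_of_mul_le_mul_left h1 hk
        omega
      subst hq
      by_cases hx : x = 0
      · simp [multipleRun, hx]
      · obtain ⟨h3, h4⟩ := ih (k * q + 1) (q + 1) (by rw [mul_add]; omega) (by rw [mul_add]; omega)
        have hle : ∀ t, k * q + 1 ≤ k * (q + 1 + t) := fun t => by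
          rw [mul_add, mul_add]
          omega
        simp only [multipleRun, dvd_mul_right, if_true, if_neg hx]
        refine ⟨fun t ht => ?_, ?_⟩
        · cases t with
          | zero => simpa using hx
          | succ t =>
            rw [show q + (t + 1) = q + 1 + t by omega, hcons _ (hle t)]
            exact h3 t (by omega)
        · rw [← add_assoc, hcons _ (hle _)]
          exact h4
    · have h1' := succ_le_mul_of_not_dvd hd h1
      obtain ⟨h3, h4⟩ := ih (i + 1) q h1' (by omega)
      have hle : ∀ t, i + 1 ≤ k * (q + t) := fun t => by
        rw [mul_add]
        omega
      simp only [multipleRun, if_neg hd]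
      refine ⟨fun t ht => ?_, ?_⟩
      · rw [hcons _ (hle _)]
        exact h3 t ht
      · rw [hcons _ (hle _)]
        exact h4

theorem multipleRun_le_sum (k i : ℕ) (h : List ℕ) : multipleRun k i h ≤ h.sum := by
  induction h generalizing i with
  | nil => simp [multipleRun]
  | cons x h ih =>
    have := ih (i + 1)
    simp only [multipleRun, List.sum_cons]
    split_ifs <;> omega

theorem ratioRun_ofHeights (m n : ℕ) (hn : 0 < n) (hmn : n < m) (h : List ℕ)
    (hh : IsDyck m n (ofHeights h)) :
    ratioRun m n (ofHeights h) = multipleRun (m / n) 0 h := by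
  obtain ⟨hl, hs, hv⟩ := (isDyck_ofHeights m n h).1 hh
  obtain ⟨h1, h2⟩ := multipleRun_spec (m / n) 0 0 (Nat.div_pos hmn.le hn) h (by simp)
    (by simpa using ⟨hn, hmn.le⟩)
  simp only [zero_add, tsub_zero] at h1 h2
  have hle : multipleRun (m / n) 0 h ≤ n := hs ▸ multipleRun_le_sum _ _ _
  have hpos : multipleRun (m / n) 0 h ≠ 0 := by
    cases h with
    | nil =>
      simp at hs
      omega
    | cons x h =>
      have : x ≠ 0 := by
        rintro rfl
        have := hv.1
        simp at this
        omega
      simp [multipleRun, this]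
  have hmem : multipleRun (m / n) 0 h ∈ {i : ℕ | 1 ≤ i ∧ i ≤ (ofHeights h).count true ∧
      (m / n) * i ∉ coarea (ofHeights h)} := by
    refine ⟨by omega, by rwa [count_true_ofHeights, hs], ?_⟩
    rw [mem_coarea_ofHeights, not_not]
    exact h2
  refine le_antisymm (Nat.sInf_le hmem) (le_csInf ⟨_, hmem⟩ fun i hi => ?_)
  by_contra hlt
  exact hi.2.2 ((mem_coarea_ofHeights _ _).2 (h1 i (by omega)))

theorem exists_involution_of_ncard_eq {T C : Type*} (D : T → Prop) (c : T → C) (A B : T → ℕ)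
    (hfin : ∀ x a b, {P | D P ∧ c P = x ∧ A P = a ∧ B P = b}.Finite)
    (hcard : ∀ x a b, {P | D P ∧ c P = x ∧ A P = a ∧ B P = b}.ncard =
      {P | D P ∧ c P = x ∧ A P = b ∧ B P = a}.ncard) :
    ∃ Ψ : T → T, (∀ P, D P → D (Ψ P)) ∧ (∀ P, D P → Ψ (Ψ P) = P) ∧
      ∀ P, D P → c (Ψ P) = c P ∧ A (Ψ P) = B P ∧ B (Ψ P) = A P := by
  let S : C → ℕ → ℕ → Set T := fun x a b => {P | D P ∧ c P = x ∧ A P = a ∧ B P = b}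
  have hS : ∀ x a b, Nonempty (S x a b ≃ S x b a) := fun x a b => by
    have : Finite (S x a b) := hfin x a b
    have : Finite (S x b a) := hfin x b a
    refine Finite.card_eq.1 ?_
    rw [Nat.card_coe_set_eq, Nat.card_coe_set_eq]
    exact hcard x a b
  have e : ∀ x a b, S x a b ≃ S x b a := fun x a b => (hS x a b).some
  let Ψ : T → T := fun P =>
    if hD : D P then
      if A P < B P then e (c P) (A P) (B P) ⟨P, hD, rfl, rfl, rfl⟩
      else if B P < A P then (e (c P) (B P) (A P)).symm ⟨P, hD, rfl, rfl, rfl⟩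
      else P
    else P
  have hlt : ∀ x a b (hab : a < b) (P : S x a b), Ψ P = e x a b P := by
    rintro _ _ _ hab ⟨P, hD, rfl, rfl, rfl⟩
    simp [Ψ, hD, hab]
  have hgt : ∀ x a b (hab : b < a) (P : S x a b), Ψ P = (e x b a).symm P := by
    rintro _ _ _ hab ⟨P, hD, rfl, rfl, rfl⟩
    simp [Ψ, hD, hab, hab.not_gt]
  have heq : ∀ P, A P = B P → Ψ P = P := by
    intro P hab
    simp [Ψ, hab]
  have key : ∀ P, D P → Ψ P ∈ S (c P) (B P) (A P) ∧ Ψ (Ψ P) = P := by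
    intro P hD
    rcases lt_trichotomy (A P) (B P) with hab | hab | hab
    · rw [hlt _ _ _ hab ⟨P, hD, rfl, rfl, rfl⟩]
      exact ⟨Subtype.coe_prop _, by rw [hgt _ _ _ hab]; simp⟩
    · rw [heq P hab]
      exact ⟨⟨hD, rfl, hab, hab.symm⟩, heq P hab⟩
    · rw [hgt _ _ _ hab ⟨P, hD, rfl, rfl, rfl⟩]
      exact ⟨Subtype.coe_prop _, by rw [hlt _ _ _ hab]; simp⟩
  exact ⟨Ψ, fun P hD => (key P hD).1.1, fun P hD => (key P hD).2, fun P hD => (key P hD).1.2⟩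

theorem sum_filter_ne_zero (h : List ℕ) : (h.filter fun x => x ≠ 0).sum = h.sum := by
  induction h with
  | nil => simp
  | cons x h ih => by_cases hx : x = 0 <;> simp_all

theorem setOf_stats_eq {m n : ℕ} (hn : 0 < n) (hmn : n < m) (α : List ℕ) (hα : ∀ a ∈ α, 0 < a)
    (hs : α.sum = n) (a j : ℕ) :
    {P | IsDyck m n P ∧ compType P = α ∧ retStat m n P = a ∧ ratioRun m n P = j} =
      ofHeights '' ((heightLists m n m 0 0 α).filter fun h =>
        decide (returns m n 0 0 h = a ∧ multipleRun (m / n) 0 h = j)).toFinset := by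
  ext P
  have hmem := fun h => mem_heightLists hmn m 0 0 α h (by omega) (by omega) (by simp) hα
  simp only [Set.mem_ofPred_eq, Set.mem_image, List.coe_toFinset, List.mem_filter, hmem,
    decide_eq_true_eq]
  constructor
  · rintro ⟨hP, hc, ha, hj⟩
    obtain ⟨h, rfl⟩ := hP.exists_ofHeights (by omega)
    obtain ⟨h1, -, h3⟩ := (isDyck_ofHeights m n h).1 hP
    rw [retStat_ofHeights m n hmn h h3] at ha
    rw [ratioRun_ofHeights m n hn hmn h hP] at hj
    rw [compType_ofHeights] at hc
    exact ⟨h, ⟨⟨h1, hc, h3⟩, ha, hj⟩, rfl⟩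
  · rintro ⟨h, ⟨⟨h1, hc, h3⟩, ha, hj⟩, rfl⟩
    have hsum : h.sum = n := by
      rw [← hs, ← hc]
      exact (sum_filter_ne_zero h).symm
    have hP : IsDyck m n (ofHeights h) := (isDyck_ofHeights m n h).2 ⟨h1, hsum, h3⟩
    exact ⟨hP, by rw [compType_ofHeights, hc], by rw [retStat_ofHeights m n hmn h h3, ha],
      by rw [ratioRun_ofHeights m n hn hmn h hP, hj]⟩

theorem ncard_stats {m n : ℕ} (hn : 0 < n) (hmn : n < m) (α : List ℕ) (hα : ∀ a ∈ α, 0 < a)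
    (hs : α.sum = n) (a j : ℕ) :
    {P | IsDyck m n P ∧ compType P = α ∧ retStat m n P = a ∧ ratioRun m n P = j}.ncard =
      (heightLists m n m 0 0 α).countP fun h =>
        decide (returns m n 0 0 h = a ∧ multipleRun (m / n) 0 h = j) := by
  rw [setOf_stats_eq hn hmn α hα hs, Set.ncard_image_of_injective _ ofHeights_injective,
    Set.ncard_coe_finset, List.toFinset_card_of_nodup ((nodup_heightLists _ _ _ _ hα).filter _),
    List.countP_eq_length_filter]

/-- For `m > n` there is a composition-type preserving involution `Ψ` on
`D_{m,n}` exchanging the statistics `r̃un` (ratio-run) and `ret`. -/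
theorem ratioRun_ret_involution (m n : ℕ) (hn : 0 < n) (hmn : n < m) :
    ∃ Ψ : Path → Path,
      (∀ P : Path, IsDyck m n P → IsDyck m n (Ψ P)) ∧
      (∀ P : Path, IsDyck m n P → Ψ (Ψ P) = P) ∧
      (∀ P : Path, IsDyck m n P →
        compType (Ψ P) = compType P ∧
        ratioRun m n (Ψ P) = retStat m n P ∧
        retStat m n (Ψ P) = ratioRun m n P) := by
  have hα : ∀ α : List ℕ, ((∀ a ∈ α, 0 < a) ∧ α.sum = n) ∨
      ∀ P, IsDyck m n P → compType P ≠ α := by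
    intro α
    by_contra! hα
    obtain ⟨hne, P, hP, rfl⟩ := hα
    obtain ⟨h, rfl⟩ := hP.exists_ofHeights (by omega)
    rw [compType_ofHeights] at hne
    refine hne (fun a ha => ?_) ?_
    · exact Nat.pos_of_ne_zero (by simpa using (List.mem_filter.1 ha).2)
    · rw [sum_filter_ne_zero]
      exact ((isDyck_ofHeights m n h).1 hP).2.1
  have hempty : ∀ α : List ℕ, (∀ P, IsDyck m n P → compType P ≠ α) → ∀ a j,
      {P | IsDyck m n P ∧ compType P = α ∧ retStat m n P = a ∧ ratioRun m n P = j} = ∅ :=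
    fun α h a j => Set.eq_empty_of_forall_notMem fun P hP => h P hP.1 hP.2.1
  obtain ⟨Ψ, h1, h2, h3⟩ := exists_involution_of_ncard_eq (IsDyck m n) compType (retStat m n)
    (ratioRun m n)
    (fun α a j => by
      rcases hα α with ⟨hα, hs⟩ | h
      · rw [setOf_stats_eq hn hmn α hα hs]
        exact (Finset.finite_toSet _).image _
      · rw [hempty α h]
        exact Set.finite_empty)
    (fun α a j => by
      rcases hα α with ⟨hα, hs⟩ | h
      · rw [ncard_stats hn hmn α hα hs, ncard_stats hn hmn α hα hs]
        exact heightLists_stats_comm hn hmn α hα hs a j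
      · rw [hempty α h, hempty α h])
  exact ⟨Ψ, h1, h2, fun P hP => ⟨(h3 P hP).1, (h3 P hP).2.2, (h3 P hP).2.1⟩⟩

end RationalDyck
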